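/- Fix an integer d ≥ 2 and a finite (possibly empty) set Σ of primes. Let W_Σ := {C ∈ 𝒫 : p does not divide 𝔯(C) for every p ∈ Σ, and p^{2d} does not divide 𝔯(C) for every prime p}. Then the height density 𝔡(W_Σ) := lim_{x→∞} #W_Σ(x)/#𝒫(x) exists and equals (∏_{p∈Σ} π_p^{(1)})·(∏_{p∉Σ} π_p^{(2d)}), where the infinite product over primes p ∉ Σ is the limit of the partial products over p ≤ Z, p ∉ Σ, as Z → ∞ (this limit exists since each factor lies in [0,1]). -/

import Mathlib

open Filter MvPolynomial

noncomputable section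

/-- The `2d × 2d` Sylvester matrix of the two generic binary forms of degree `d`,
with entries taken from the coordinates of `Q` (the first `d+1` coordinates of `Q`
are the coefficients of `F`, the last `d+1` ones those of `G`). -/
def sylvesterMat (d : ℕ) {R : Type*} [CommRing R] (Q : Fin (2 * d + 2) → R) :
    Matrix (Fin (2 * d)) (Fin (2 * d)) R :=
  Matrix.of fun i j =>
    if hi : (i : ℕ) < d then
      if h : (i : ℕ) ≤ (j : ℕ) ∧ (j : ℕ) ≤ (i : ℕ) + d then
        Q ⟨(j : ℕ) - (i : ℕ), by omega⟩
      else 0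
    else
      if h : (i : ℕ) - d ≤ (j : ℕ) ∧ (j : ℕ) ≤ (i : ℕ) then
        Q ⟨d + 1 + ((j : ℕ) - ((i : ℕ) - d)), by omega⟩
      else 0

/-- The generic resultant polynomial `𝔯 ∈ ℤ[x₀,…,x_d,y₀,…,y_d]`:
the determinant of the Sylvester matrix of the generic binary forms of degree `d`. -/
def resPoly (d : ℕ) : MvPolynomial (Fin (2 * d + 2)) ℤ :=
  Matrix.det (sylvesterMat d fun i => X i)

/-- Evaluation `𝔯(Q)` of the generic resultant at a tuple `Q` with entries in a
commutative ring (i.e. evaluation of the image of `𝔯` under the coefficient map `ℤ → R`). -/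
def resEval (d : ℕ) {R : Type*} [CommRing R] (Q : Fin (2 * d + 2) → R) : R :=
  aeval Q (resPoly d)

/-- The set `𝒫 ⊆ ℤ^{2d+2}` identified with `ℙ^{2d+1}(ℚ)`: integer tuples with gcd `1`
whose first nonzero coordinate is positive. -/
def projPts (d : ℕ) : Set (Fin (2 * d + 2) → ℤ) :=
  {C | Finset.univ.gcd C = 1 ∧ ∃ i, 0 < C i ∧ ∀ j, j < i → C j = 0}

/-- The box of integer tuples with `|xᵢ| ≤ rᵢ` for all `i`. -/
def box {m : ℕ} (r : Fin m → ℝ) : Set (Fin m → ℤ) :=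
  {x | ∀ i, |(x i : ℝ)| ≤ r i}

/-- The value `ζ(k)` of the Riemann zeta function at an integer `k` (for `k ≥ 2`). -/
def zetaVal (k : ℕ) : ℝ := ∑' n : ℕ+, (1 : ℝ) / ((n : ℕ) : ℝ) ^ k

/-- The local factor `π_p^{(k)}`. -/
def piLocal (d p k : ℕ) : ℝ :=
  (Nat.card {Q : Fin (2 * d + 2) → ZMod (p ^ k) // resEval d Q ≠ 0} : ℝ) /
    ((p : ℝ) ^ ((2 * d + 2) * k) * (1 - 1 / (p : ℝ) ^ (2 * d + 2)))

/-- The set `W_Σ`: tuples in `𝒫` with `2d`-power free resultant and resultant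
not divisible by any `p ∈ Σ` (good reduction at `Σ`). -/
def WSigma (d : ℕ) (Sig : Finset ℕ) : Set (Fin (2 * d + 2) → ℤ) :=
  {C | C ∈ projPts d ∧ (∀ p ∈ Sig, ¬ (p : ℤ) ∣ resEval d C) ∧
    ∀ p : ℕ, p.Prime → ¬ (p : ℤ) ^ (2 * d) ∣ resEval d C}

section Sylvester

variable {d : ℕ} {R S : Type*} [CommRing R] [CommRing S]

theorem resEval_eq_det (Q : Fin (2 * d + 2) → R) : resEval d Q = (sylvesterMat d Q).det := by
  unfold resEval resPoly
  rw [AlgHom.map_det]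
  congr 1
  ext i j
  simp only [sylvesterMat, AlgHom.mapMatrix_apply, Matrix.map_apply, Matrix.of_apply]
  split_ifs <;> simp

theorem map_resEval (f : R →+* S) (Q : Fin (2 * d + 2) → R) :
    f (resEval d Q) = resEval d fun i => f (Q i) := by
  rw [resEval_eq_det, resEval_eq_det, RingHom.map_det]
  congr 1
  ext i j
  simp only [sylvesterMat, RingHom.mapMatrix_apply, Matrix.map_apply, Matrix.of_apply]
  split_ifs <;> simp

theorem resEval_smul (c : R) (Q : Fin (2 * d + 2) → R) :
    resEval d (c • Q) = c ^ (2 * d) * resEval d Q := by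
  have h : sylvesterMat d (c • Q) = c • sylvesterMat d Q := by
    ext i j
    simp only [sylvesterMat, Matrix.smul_apply, Matrix.of_apply]
    split_ifs <;> simp
  rw [resEval_eq_det, resEval_eq_det, h, Matrix.det_smul, Fintype.card_fin]

theorem abs_resEval_le {N : ℕ} {C : Fin (2 * d + 2) → ℤ} (hC : ∀ i, |C i| ≤ N) :
    |resEval d C| ≤ (2 * d).factorial * (N : ℤ) ^ (2 * d) := by
  have h := Matrix.det_le (A := sylvesterMat d C) (abv := AbsoluteValue.abs) (x := (N : ℤ))
    fun i j => by
      simp only [sylvesterMat, Matrix.of_apply, AbsoluteValue.abs_apply]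
      split_ifs <;> simp [hC]
  rw [resEval_eq_det]
  simpa using h

theorem sylvesterMat_update_last (C : Fin (2 * d + 2) → R) (t : R) (i j : Fin (2 * d)) :
    sylvesterMat d (Function.update C (Fin.last _) t) i j =
      sylvesterMat d (Function.update C (Fin.last _) 0) i j +
        if d ≤ (i : ℕ) ∧ i = j then t else 0 := by
  obtain ⟨i, hi⟩ := i
  obtain ⟨j, hj⟩ := j
  simp only [sylvesterMat, Matrix.of_apply, Function.update_apply, Fin.ext_iff, Fin.val_last]
  split_ifs <;> first | omega | simp

theorem sylvesterMat_update_zero (C : Fin (2 * d + 2) → R) (t : R) (i j : Fin (2 * d)) :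
    sylvesterMat d (Function.update C 0 t) i j =
      sylvesterMat d (Function.update C 0 0) i j +
        if (i : ℕ) < d ∧ i = j then t else 0 := by
  obtain ⟨i, hi⟩ := i
  obtain ⟨j, hj⟩ := j
  simp only [sylvesterMat, Matrix.of_apply, Function.update_apply, Fin.ext_iff, Fin.val_zero]
  split_ifs <;> first | omega | simp

/-- The splitting of the indices of a `2d × 2d` matrix into two halves. -/
def halvesEquiv (d : ℕ) : Fin d ⊕ Fin d ≃ Fin (2 * d) :=
  finSumFinEquiv.trans (finCongr (two_mul d).symm)

@[simp] theorem halvesEquiv_inl (i : Fin d) : (halvesEquiv d (Sum.inl i) : ℕ) = i := by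
  simp [halvesEquiv]

@[simp] theorem halvesEquiv_inr (i : Fin d) : (halvesEquiv d (Sum.inr i) : ℕ) = d + i := by
  simp [halvesEquiv, add_comm]

/-- If the `Y^d` coefficient of the first form is a nonzero `a`, then the resultant is `a ^ d` times
a monic polynomial of degree `d` in the `X^d` coefficient of the second form. -/
theorem exists_monic_resEval_update_last (C : Fin (2 * d + 2) → ℚ) (h0 : C 0 ≠ 0) :
    ∃ P : Polynomial ℚ, P.Monic ∧ P.natDegree = d ∧
      ∀ t, resEval d (Function.update C (Fin.last _) t) = C 0 ^ d * P.eval t := by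
  set S := (sylvesterMat d (Function.update C (Fin.last _) 0)).submatrix
    (halvesEquiv d) (halvesEquiv d) with hS
  have hdet : S.toBlocks₁₁.det = C 0 ^ d := by
    rw [Matrix.det_of_isUpperTriangular]
    · rw [Finset.prod_congr rfl (g := fun _ => C 0), Finset.prod_const, Finset.card_univ,
        Fintype.card_fin]
      intro i _
      simp [hS, Matrix.toBlocks₁₁, sylvesterMat, Function.update_apply, Fin.ext_iff]
    · intro i j hij
      have : ¬ ((i : ℕ) ≤ j) := by simpa using hij
      simp only [hS, Matrix.toBlocks₁₁, sylvesterMat, Matrix.of_apply, Matrix.submatrix_apply,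
        halvesEquiv_inl]
      split_ifs <;> first | omega | rfl
  have hu : IsUnit S.toBlocks₁₁.det := by
    rw [hdet]; exact (pow_ne_zero _ h0).isUnit
  let _ := Matrix.invertibleOfIsUnitDet _ hu
  refine ⟨(S.toBlocks₂₁ * ⅟S.toBlocks₁₁ * S.toBlocks₁₂ - S.toBlocks₂₂).charpoly,
    Matrix.charpoly_monic _, by simp, fun t => ?_⟩
  rw [resEval_eq_det, ← Matrix.det_submatrix_equiv_self (halvesEquiv d), Matrix.eval_charpoly,
    ← hdet]
  have hb : (sylvesterMat d (Function.update C (Fin.last _) t)).submatrix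
      (halvesEquiv d) (halvesEquiv d) = Matrix.fromBlocks S.toBlocks₁₁ S.toBlocks₁₂ S.toBlocks₂₁
        (S.toBlocks₂₂ + Matrix.scalar _ t) := by
    ext (i | i) (j | j) <;>
      simp [sylvesterMat_update_last C t, hS, Matrix.toBlocks₁₁, Matrix.toBlocks₁₂,
        Matrix.toBlocks₂₁, Matrix.toBlocks₂₂, Matrix.diagonal_apply]
  rw [hb, Matrix.det_fromBlocks₁₁]
  congr 2
  abel

/-- If the `X^d` coefficient of the second form is a nonzero `a`, then the resultant is `a ^ d`
times a monic polynomial of degree `d` in the `Y^d` coefficient of the first form. -/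
theorem exists_monic_resEval_update_zero (C : Fin (2 * d + 2) → ℚ) (h0 : C (Fin.last _) ≠ 0) :
    ∃ P : Polynomial ℚ, P.Monic ∧ P.natDegree = d ∧
      ∀ t, resEval d (Function.update C 0 t) = C (Fin.last _) ^ d * P.eval t := by
  set S := (sylvesterMat d (Function.update C 0 0)).submatrix
    (halvesEquiv d) (halvesEquiv d) with hS
  have hdet : S.toBlocks₂₂.det = C (Fin.last _) ^ d := by
    rw [Matrix.det_of_isLowerTriangular]
    · rw [Finset.prod_congr rfl (g := fun _ => C (Fin.last _)), Finset.prod_const,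
        Finset.card_univ, Fintype.card_fin]
      intro i _
      simp [hS, Matrix.toBlocks₂₂, sylvesterMat, Function.update_apply, Fin.ext_iff]
      congr 1
      ext
      simp
      omega
    · intro i j hij
      have : ¬ ((j : ℕ) ≤ i) := by simpa using hij
      simp only [hS, Matrix.toBlocks₂₂, sylvesterMat, Matrix.of_apply, Matrix.submatrix_apply,
        halvesEquiv_inr]
      split_ifs <;> first | omega | rfl
  have hu : IsUnit S.toBlocks₂₂.det := by
    rw [hdet]; exact (pow_ne_zero _ h0).isUnit
  let _ := Matrix.invertibleOfIsUnitDet _ hu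
  refine ⟨(S.toBlocks₁₂ * ⅟S.toBlocks₂₂ * S.toBlocks₂₁ - S.toBlocks₁₁).charpoly,
    Matrix.charpoly_monic _, by simp, fun t => ?_⟩
  rw [resEval_eq_det, ← Matrix.det_submatrix_equiv_self (halvesEquiv d), Matrix.eval_charpoly,
    ← hdet]
  have hb : (sylvesterMat d (Function.update C 0 t)).submatrix
      (halvesEquiv d) (halvesEquiv d) = Matrix.fromBlocks (S.toBlocks₁₁ + Matrix.scalar _ t)
        S.toBlocks₁₂ S.toBlocks₂₁ S.toBlocks₂₂ := by
    ext (i | i) (j | j) <;>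
      simp [sylvesterMat_update_zero C t, hS, Matrix.toBlocks₁₁, Matrix.toBlocks₁₂,
        Matrix.toBlocks₂₁, Matrix.toBlocks₂₂, Matrix.diagonal_apply, Fin.ext_iff]
  rw [hb, Matrix.det_fromBlocks₂₂]
  congr 2
  abel

end Sylvester
section Counting

/-- Let `f` be `a ^ d` times a monic rational polynomial of degree `d`, taking integral values at
integers. If `p ∤ a`, then the integers `t` with `p ^ (2 * d) ∣ f t` lie in at most `d` residue
classes modulo `p ^ 2`. -/
theorem card_image_zmod_sq_le {p d : ℕ} (hp : p.Prime) {f : ℤ → ℤ} {a : ℤ} (ha : ¬ (p : ℤ) ∣ a)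
    {P : Polynomial ℚ} (hP : P.Monic) (hPd : P.natDegree = d)
    (hf : ∀ t : ℤ, (f t : ℚ) = (a : ℚ) ^ d * P.eval (t : ℚ)) (hd : d ≠ 0) {T : Finset ℤ}
    (hT : ∀ t ∈ T, (p : ℤ) ^ (2 * d) ∣ f t) :
    (T.image fun t : ℤ => (t : ZMod (p ^ 2))).card ≤ d := by
  have := Fact.mk hp
  by_contra! hlt
  obtain ⟨V, hV, hVc⟩ := Finset.exists_subset_card_eq (Nat.succ_le_of_lt hlt)
  obtain ⟨U, hUT, hinj, hUV⟩ := Finset.exists_subset_injOn_image_eq_of_surjOn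
    (f := fun t : ℤ => (t : ZMod (p ^ 2))) (T : Set ℤ) V (by
      intro c hc
      simpa using hV hc)
  have hUc : U.card = d + 1 := by
    rw [← Finset.card_image_of_injOn hinj, hUV, hVc]
  have hL := Lagrange.leadingCoeff_eq_sum (s := U) (v := fun t : ℤ => (t : ℚ)) (P := P)
    (fun x _ y _ h => by simpa using h) (by
      rw [Polynomial.degree_eq_natDegree hP.ne_zero, hPd, hUc]; simp)
  rw [hP.leadingCoeff] at hL
  have hsum : (a : ℚ) ^ d = ∑ t ∈ U, (f t : ℚ) / ∏ j ∈ U.erase t, ((t : ℚ) - j) := by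
    calc (a : ℚ) ^ d = (a : ℚ) ^ d * 1 := (mul_one _).symm
      _ = _ := by
        rw [hL, Finset.mul_sum]
        exact Finset.sum_congr rfl fun t _ => by rw [hf, mul_div_assoc]
  have hp0 : (0 : ℚ) < p := by exact_mod_cast hp.pos
  have hnorm : padicNorm p ((a : ℚ) ^ d) = 1 := by
    have h1 : padicNorm p (a : ℚ) = 1 := by
      rw [padicNorm.int_eq_one_iff]; exact ha
    have h2 : ∀ k : ℕ, padicNorm p ((a : ℚ) ^ k) = 1 := by
      intro k
      induction k with
      | zero => simp
      | succ k ih => rw [pow_succ, padicNorm.mul, ih, h1, one_mul]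
    exact h2 d
  have hdiff : ∀ t ∈ U, ∀ j ∈ U.erase t, (p : ℚ)⁻¹ ≤ padicNorm p ((t : ℚ) - j) := by
    intro t ht j hj
    rw [Finset.mem_erase] at hj
    by_contra! hlt
    have h2 : ((p ^ 2 : ℕ) : ℤ) ∣ t - j := by
      have hne : ((t - j : ℤ) : ℚ) ≠ 0 := by
        exact_mod_cast sub_ne_zero.2 (Ne.symm hj.1)
      have := (padicNorm.dvd_iff_norm_le (p := p) (n := 2) (z := t - j)).2 (by
        have hz := padicNorm.eq_zpow_of_nonzero (p := p) hne
        push_cast at hz ⊢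
        rw [hz] at hlt ⊢
        rw [← zpow_neg_one, zpow_lt_zpow_iff_right₀ (by exact_mod_cast hp.one_lt)] at hlt
        exact zpow_le_zpow_right₀ (by exact_mod_cast hp.one_le) (by omega))
      exact_mod_cast this
    refine hj.1 (hinj hj.2 ht ?_)
    have := (ZMod.intCast_zmod_eq_zero_iff_dvd (t - j) (p ^ 2)).2 h2
    push_cast at this
    exact (sub_eq_zero.1 this).symm
  have hlt : padicNorm p ((a : ℚ) ^ d) < 1 := by
    rw [hsum]
    refine padicNorm.sum_lt' (fun t ht => ?_) one_pos
    have hprod : ∀ W : Finset ℤ, W ⊆ U.erase t →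
        ((p : ℚ)⁻¹) ^ W.card ≤ padicNorm p (∏ j ∈ W, ((t : ℚ) - j)) := by
      intro W
      induction W using Finset.induction_on with
      | empty => simp
      | insert j W hj ih =>
        intro hW
        rw [Finset.card_insert_of_notMem hj, Finset.prod_insert hj, pow_succ', padicNorm.mul]
        exact mul_le_mul (hdiff t ht j (hW (Finset.mem_insert_self _ _)))
          (ih ((Finset.subset_insert _ _).trans hW)) (by positivity) (padicNorm.nonneg _)
    have hden := hprod _ subset_rfl
    rw [Finset.card_erase_of_mem ht, hUc, Nat.add_sub_cancel] at hden
    have hnum : padicNorm p (f t : ℚ) ≤ ((p : ℚ)⁻¹) ^ (2 * d) := by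
      have := (padicNorm.dvd_iff_norm_le (p := p) (n := 2 * d) (z := f t)).1
        (by exact_mod_cast hT t (hUT ht))
      rwa [zpow_neg, zpow_natCast, ← inv_pow] at this
    have hpos : 0 < ((p : ℚ)⁻¹) ^ d := by positivity
    rw [padicNorm.div, div_lt_one (hpos.trans_le hden)]
    refine hnum.trans_lt (lt_of_lt_of_le ?_ hden)
    exact pow_lt_pow_right_of_lt_one₀ (by positivity)
      (inv_lt_one_of_one_lt₀ (by exact_mod_cast hp.one_lt)) (by omega)
  exact hlt.ne hnorm

/-- The number of integers in `[-N, N]` in a given residue class modulo `m`. -/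
theorem abs_card_residue_sub_le (N : ℕ) {m : ℕ} (hm : m ≠ 0) (c : ZMod m) :
    |((((Finset.Icc (-N : ℤ) N).filter fun t : ℤ => (t : ZMod m) = c).card : ℕ) : ℝ) -
      (2 * N + 1) / m| ≤ 1 := by
  obtain ⟨v, rfl⟩ := ZMod.intCast_surjective c
  have hm0 : (0 : ℤ) < m := by exact_mod_cast Nat.pos_of_ne_zero hm
  have hI : ((Finset.Icc (-N : ℤ) N).filter fun t : ℤ => (t : ZMod m) = v) =
      (Finset.Ioc (-N - 1 : ℤ) N).filter fun t : ℤ => t ≡ v [ZMOD m] := by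
    ext t
    simp only [Finset.mem_filter, Finset.mem_Icc, Finset.mem_Ioc, ZMod.intCast_eq_intCast_iff]
    constructor <;> rintro ⟨⟨h1, h2⟩, h3⟩ <;> exact ⟨⟨by omega, h2⟩, h3⟩
  have hcard := Int.Ioc_filter_modEq_card (-N - 1 : ℤ) N hm0 v
  rw [← hI] at hcard
  set k := ((Finset.Icc (-N : ℤ) N).filter fun t : ℤ => (t : ZMod m) = v).card
  push_cast at hcard
  have hmq : (0 : ℚ) < m := by exact_mod_cast hm0
  have hle : ⌊((-N - 1 : ℚ) - v) / m⌋ ≤ ⌊((N : ℚ) - v) / m⌋ := by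
    apply Int.floor_le_floor
    gcongr
    linarith [(Nat.cast_nonneg N : (0 : ℚ) ≤ N)]
  rw [max_eq_left (by omega)] at hcard
  have h1 := Int.floor_le (((-N - 1 : ℚ) - v) / m)
  have h2 := Int.lt_floor_add_one (((-N - 1 : ℚ) - v) / m)
  have h3 := Int.floor_le (((N : ℚ) - v) / m)
  have h4 := Int.lt_floor_add_one (((N : ℚ) - v) / m)
  have hq : |(k : ℚ) - (2 * N + 1) / m| ≤ 1 := by
    have hk : (k : ℚ) = ⌊((N : ℚ) - v) / m⌋ - ⌊((-N - 1 : ℚ) - v) / m⌋ := by exact_mod_cast hcard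
    have he : ((2 * N + 1 : ℚ)) / m = ((N : ℚ) - v) / m - ((-N - 1 : ℚ) - v) / m := by ring
    rw [abs_le]
    constructor <;> linarith
  have hr := (Rat.cast_le (K := ℝ)).2 hq
  push_cast at hr
  exact hr

/-- A set of integers in `[-N, N]` that meets at most `k` residue classes modulo `m`. -/
theorem card_le_of_card_image_zmod_le {N m k : ℕ} (hm : m ≠ 0) {T : Finset ℤ}
    (hT : T ⊆ Finset.Icc (-N : ℤ) N) (hk : (T.image fun t : ℤ => (t : ZMod m)).card ≤ k) :
    (T.card : ℝ) ≤ k * ((2 * N + 1) / m + 1) := by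
  have h := Finset.card_eq_sum_card_image (fun t : ℤ => (t : ZMod m)) T
  rw [h]
  push_cast
  calc _ ≤ ∑ _c ∈ T.image (fun t : ℤ => (t : ZMod m)), ((2 * N + 1 : ℝ) / m + 1) := by
        refine Finset.sum_le_sum fun c _ => ?_
        have h1 := (abs_le.1 (abs_card_residue_sub_le N hm c)).2
        have h2 : ((T.filter fun t : ℤ => (t : ZMod m) = c).card : ℝ) ≤
            ((Finset.Icc (-N : ℤ) N).filter fun t : ℤ => (t : ZMod m) = c).card := by
          exact_mod_cast Finset.card_le_card (Finset.filter_subset_filter _ hT)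
        linarith
    _ ≤ _ := by
        rw [Finset.sum_const, nsmul_eq_mul]
        gcongr

/-- The integer points of the cube `[-N, N]^n`. -/
def cube (n N : ℕ) : Finset (Fin n → ℤ) :=
  Fintype.piFinset fun _ => Finset.Icc (-N : ℤ) N

theorem mem_cube {n N : ℕ} {C : Fin n → ℤ} : C ∈ cube n N ↔ ∀ i, |C i| ≤ N := by
  simp [cube, abs_le]

theorem card_cube (n N : ℕ) : (cube n N).card = (2 * N + 1) ^ n := by
  rw [cube, Fintype.card_piFinset, Finset.prod_const, Finset.card_univ, Fintype.card_fin,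
    Int.card_Icc]
  congr 1
  omega

/-- Counting the points of a cube along the lines parallel to a coordinate axis. -/
theorem card_filter_cube_le_of_update {n N : ℕ} (i : Fin (n + 1)) (A : (Fin (n + 1) → ℤ) → Prop)
    [DecidablePred A] {B : ℝ}
    (hB : ∀ C, (((Finset.Icc (-N : ℤ) N).filter fun t => A (Function.update C i t)).card : ℝ) ≤ B) :
    (((cube (n + 1) N).filter A).card : ℝ) ≤ B * (2 * N + 1) ^ n := by
  have hmaps : ∀ C ∈ (cube (n + 1) N).filter A,
      (fun j => C (i.succAbove j)) ∈ cube n N := by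
    intro C hC
    rw [Finset.mem_filter, mem_cube] at hC
    exact mem_cube.2 fun j => hC.1 _
  rw [Finset.card_eq_sum_card_fiberwise hmaps]
  push_cast
  calc _ ≤ ∑ _c ∈ cube n N, B := by
        refine Finset.sum_le_sum fun c _ => le_trans ?_ (hB (i.insertNth 0 c))
        norm_cast
        refine Finset.card_le_card_of_injOn (fun C => C i) ?_ ?_
        · intro C hC
          simp only [Finset.coe_filter, Finset.mem_filter, mem_cube, Set.mem_ofPred_eq,
            Finset.mem_Icc] at hC ⊢
          obtain ⟨⟨hC, hA⟩, rfl⟩ := hC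
          refine ⟨abs_le.1 (hC i), ?_⟩
          convert hA using 1
          ext j
          refine Fin.succAboveCases i ?_ (fun k => ?_) j <;> simp
        · intro C hC C' hC' h
          simp only [Finset.coe_filter, Set.mem_ofPred_eq] at hC hC'
          ext j
          refine Fin.succAboveCases i h (fun k => ?_) j
          exact congrFun (hC.2.trans hC'.2.symm) k
    _ = _ := by
        rw [Finset.sum_const, card_cube, nsmul_eq_mul]
        push_cast
        ring

end Counting
section Tail

variable {d : ℕ}

theorem cast_resEval_update (C : Fin (2 * d + 2) → ℤ) (i : Fin (2 * d + 2)) (t : ℤ) :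
    ((resEval d (Function.update C i t) : ℤ) : ℚ) =
      resEval d (Function.update (fun j => (C j : ℚ)) i t) := by
  have h := map_resEval (Int.castRingHom ℚ) (Function.update C i t)
  rw [eq_intCast] at h
  rw [h]
  congr 1
  ext j
  by_cases hj : j = i
  · subst hj; simp
  · simp [hj]

theorem card_filter_not_dvd_zero_le (hd : d ≠ 0) {p : ℕ} (hp : p.Prime) (N : ℕ) :
    (((cube (2 * d + 2) N).filter fun C =>
      ¬ (p : ℤ) ∣ C 0 ∧ (p : ℤ) ^ (2 * d) ∣ resEval d C).card : ℝ) ≤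
      d * ((2 * N + 1) / p ^ 2 + 1) * (2 * N + 1) ^ (2 * d + 1) := by
  refine card_filter_cube_le_of_update (Fin.last _) _ fun C => ?_
  have hne : (0 : Fin (2 * d + 2)) ≠ Fin.last _ := Fin.last_pos.ne
  simp only [Function.update_of_ne hne]
  by_cases h0 : (p : ℤ) ∣ C 0
  · simp only [h0, not_true_eq_false, false_and, Finset.filter_false, Finset.card_empty,
      Nat.cast_zero]
    positivity
  · obtain ⟨P, hP, hPd, hPe⟩ := exists_monic_resEval_update_last (fun j => (C j : ℚ))
      (by rintro h; exact h0 (by rw [Int.cast_eq_zero.1 h]; exact dvd_zero _))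
    have := card_le_of_card_image_zmod_le (m := p ^ 2) (k := d) (pow_ne_zero _ hp.ne_zero)
      (Finset.filter_subset (fun t => ¬ (p : ℤ) ∣ C 0 ∧
        (p : ℤ) ^ (2 * d) ∣ resEval d (Function.update C (Fin.last _) t)) (Finset.Icc (-N : ℤ) N))
      (card_image_zmod_sq_le hp h0 hP hPd
        (f := fun t => resEval d (Function.update C (Fin.last _) t))
        (fun t => by rw [cast_resEval_update, hPe]) hd
        fun t ht => (Finset.mem_filter.1 ht).2.2)
    simpa using this

theorem card_filter_not_dvd_last_le (hd : d ≠ 0) {p : ℕ} (hp : p.Prime) (N : ℕ) :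
    (((cube (2 * d + 2) N).filter fun C =>
      ¬ (p : ℤ) ∣ C (Fin.last _) ∧ (p : ℤ) ^ (2 * d) ∣ resEval d C).card : ℝ) ≤
      d * ((2 * N + 1) / p ^ 2 + 1) * (2 * N + 1) ^ (2 * d + 1) := by
  refine card_filter_cube_le_of_update 0 _ fun C => ?_
  have hne : Fin.last (2 * d + 1) ≠ 0 := Fin.last_pos.ne'
  simp only [Function.update_of_ne hne]
  by_cases h0 : (p : ℤ) ∣ C (Fin.last _)
  · simp only [h0, not_true_eq_false, false_and, Finset.filter_false, Finset.card_empty,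
      Nat.cast_zero]
    positivity
  · obtain ⟨P, hP, hPd, hPe⟩ := exists_monic_resEval_update_zero (fun j => (C j : ℚ))
      (by rintro h; exact h0 (by rw [Int.cast_eq_zero.1 h]; exact dvd_zero _))
    have := card_le_of_card_image_zmod_le (m := p ^ 2) (k := d) (pow_ne_zero _ hp.ne_zero)
      (Finset.filter_subset (fun t => ¬ (p : ℤ) ∣ C (Fin.last _) ∧
        (p : ℤ) ^ (2 * d) ∣ resEval d (Function.update C 0 t)) (Finset.Icc (-N : ℤ) N))
      (card_image_zmod_sq_le hp h0 hP hPd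
        (f := fun t => resEval d (Function.update C 0 t))
        (fun t => by rw [cast_resEval_update, hPe]) hd
        fun t ht => (Finset.mem_filter.1 ht).2.2)
    simpa using this

theorem card_filter_dvd_zero_and_last_le {m p : ℕ} (hp : p ≠ 0) (N : ℕ) :
    (((cube (m + 2) N).filter fun C => (p : ℤ) ∣ C 0 ∧ (p : ℤ) ∣ C (Fin.last _)).card : ℝ) ≤
      ((2 * N + 1) / p + 1) ^ 2 * (2 * N + 1) ^ m := by
  set I := Finset.Icc (-N : ℤ) N
  set J := I.filter fun t : ℤ => (t : ZMod p) = 0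
  have hJ : (J.card : ℝ) ≤ (2 * N + 1) / p + 1 := by
    linarith [(abs_le.1 (abs_card_residue_sub_le N hp 0)).2]
  have hI : (I.card : ℝ) = 2 * N + 1 := by
    have : I.card = 2 * N + 1 := by rw [Int.card_Icc]; omega
    rw [this]; push_cast; ring
  have hsub : ((cube (m + 2) N).filter fun C => (p : ℤ) ∣ C 0 ∧ (p : ℤ) ∣ C (Fin.last _)) ⊆
      Fintype.piFinset fun i => if i = 0 ∨ i = Fin.last _ then J else I := by
    intro C hC
    rw [Finset.mem_filter, cube, Fintype.mem_piFinset] at hC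
    rw [Fintype.mem_piFinset]
    intro i
    split_ifs with hi
    · refine Finset.mem_filter.2 ⟨hC.1 i, (ZMod.intCast_zmod_eq_zero_iff_dvd _ _).2 ?_⟩
      rcases hi with rfl | rfl
      exacts [hC.2.1, hC.2.2]
    · exact hC.1 i
  have hcard : ((Fintype.piFinset fun i : Fin (m + 2) =>
      if i = 0 ∨ i = Fin.last _ then J else I).card : ℝ) = J.card ^ 2 * I.card ^ m := by
    rw [Fintype.card_piFinset, Fin.prod_univ_succ, Fin.prod_univ_castSucc]
    have : ∀ i : Fin m, ¬ (i.castSucc.succ = 0 ∨ i.castSucc.succ = Fin.last (m + 1)) := by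
      intro i
      simp only [Fin.ext_iff, Fin.val_succ, Fin.val_castSucc, Fin.val_zero, Fin.val_last]
      omega
    simp only [this, if_false, Finset.prod_const, Finset.card_univ, Fintype.card_fin,
      Fin.succ_last, true_or, or_true, if_true]
    push_cast
    ring
  calc _ ≤ ((Fintype.piFinset fun i : Fin (m + 2) =>
      if i = 0 ∨ i = Fin.last _ then J else I).card : ℝ) := by
        exact_mod_cast Finset.card_le_card hsub
    _ ≤ _ := by
        rw [hcard, hI]
        gcongr

/-- The number of points of a cube whose resultant is divisible by `p ^ (2 * d)`. -/
theorem card_filter_pow_dvd_resEval_le (hd : d ≠ 0) {p : ℕ} (hp : p.Prime) (N : ℕ) :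
    (((cube (2 * d + 2) N).filter fun C => (p : ℤ) ^ (2 * d) ∣ resEval d C).card : ℝ) ≤
      2 * d * ((2 * N + 1) / p ^ 2 + 1) * (2 * N + 1) ^ (2 * d + 1) +
        ((2 * N + 1) / p + 1) ^ 2 * (2 * N + 1) ^ (2 * d) := by
  classical
  have h1 := card_filter_not_dvd_zero_le hd hp N
  have h2 := card_filter_not_dvd_last_le hd hp N
  have h3 := card_filter_dvd_zero_and_last_le (m := 2 * d) hp.ne_zero N
  set F1 := (cube (2 * d + 2) N).filter fun C =>
      ¬ (p : ℤ) ∣ C 0 ∧ (p : ℤ) ^ (2 * d) ∣ resEval d C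
  set F2 := (cube (2 * d + 2) N).filter fun C =>
      ¬ (p : ℤ) ∣ C (Fin.last _) ∧ (p : ℤ) ^ (2 * d) ∣ resEval d C
  set F3 := (cube (2 * d + 2) N).filter fun C => (p : ℤ) ∣ C 0 ∧ (p : ℤ) ∣ C (Fin.last _)
  have hsub : ((cube (2 * d + 2) N).filter fun C => (p : ℤ) ^ (2 * d) ∣ resEval d C) ⊆
      F1 ∪ F2 ∪ F3 := by
    intro C hC
    simp only [F1, F2, F3, Finset.mem_union, Finset.mem_filter] at hC ⊢
    tauto
  have h4 : (((cube (2 * d + 2) N).filter fun C => (p : ℤ) ^ (2 * d) ∣ resEval d C).card : ℝ) ≤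
      F1.card + F2.card + F3.card := by
    exact_mod_cast (Finset.card_le_card hsub).trans ((Finset.card_union_le _ _).trans
      (Nat.add_le_add_right (Finset.card_union_le _ _) _))
  linarith

theorem eventually_primeCounting_le_mul {ε : ℝ} (hε : 0 < ε) :
    ∀ᶠ n : ℕ in atTop, (Nat.primeCounting n : ℝ) ≤ ε * n := by
  have h1 := tendsto_natCast_atTop_atTop (R := ℝ) |>.eventually
    (Chebyshev.eventually_primeCounting_le one_pos)
  have h2 := (Real.tendsto_log_atTop.comp (tendsto_natCast_atTop_atTop (R := ℝ))).eventually_ge_atTop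
    (max 1 ((Real.log 4 + 1) / ε))
  filter_upwards [h1, h2] with n h1 h2
  rw [Nat.floor_natCast] at h1
  rw [Function.comp, max_le_iff] at h2
  refine h1.trans ?_
  have h3 := h2.2
  rw [div_le_iff₀ hε] at h3
  rw [div_le_iff₀ (by linarith)]
  nlinarith [(Nat.cast_nonneg n : (0 : ℝ) ≤ n)]

/-- A resultant divisible by `p ^ (2 * d)` for some prime `p > Z` is divisible by `p ^ (2 * d)` for
some such prime which is at most a constant times the height. -/
theorem exists_prime_le_of_pow_dvd_resEval (hd : 2 ≤ d) {N Z : ℕ} (hZ : Z < N)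
    {C : Fin (2 * d + 2) → ℤ} (hC : C ∈ cube (2 * d + 2) N)
    (h : ∃ p : ℕ, p.Prime ∧ Z < p ∧ (p : ℤ) ^ (2 * d) ∣ resEval d C) :
    ∃ p : ℕ, p.Prime ∧ Z < p ∧ p ≤ (2 * d).factorial * N ∧ (p : ℤ) ^ (2 * d) ∣ resEval d C := by
  by_cases h0 : resEval d C = 0
  · obtain ⟨q, hq, hNq, hqN⟩ := Nat.exists_prime_lt_and_le_two_mul N (by omega)
    refine ⟨q, hq, by omega, hqN.trans (Nat.mul_le_mul_right _ ?_), by simp [h0]⟩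
    exact le_trans (by omega) (Nat.self_le_factorial (2 * d))
  · obtain ⟨p, hp, hZp, hdvd⟩ := h
    refine ⟨p, hp, hZp, ?_, hdvd⟩
    have h1 := Int.le_of_dvd (abs_pos.2 h0) ((dvd_abs _ _).2 hdvd)
    have h2 := h1.trans (abs_resEval_le (mem_cube.1 hC))
    have h3 : p ^ (2 * d) ≤ (2 * d).factorial * N ^ (2 * d) := by exact_mod_cast h2
    refine (Nat.pow_le_pow_iff_left (n := 2 * d) (by omega)).1 (h3.trans ?_)
    rw [mul_pow]
    exact Nat.mul_le_mul_right _ (Nat.le_self_pow (by omega) _)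

/-- Resultants divisible by `p ^ (2 * d)` for some large prime `p` are rare. -/
theorem exists_eventually_card_filter_pow_dvd_resEval_le (hd : 2 ≤ d) {ε : ℝ} (hε : 0 < ε) :
    ∃ Z₀ : ℕ, ∀ Z ≥ Z₀, ∀ᶠ N : ℕ in atTop,
      (Nat.card {C // C ∈ cube (2 * d + 2) N ∧
        ∃ p : ℕ, p.Prime ∧ Z < p ∧ (p : ℤ) ^ (2 * d) ∣ resEval d C} : ℝ) ≤
        ε * (2 * N + 1) ^ (2 * d + 2) := by
  classical
  set K := (2 * d).factorial with hK
  have hKpos : 0 < K := Nat.factorial_pos _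
  set c : ℝ := 2 * d + (1 + K) ^ 2 with hc
  have hcpos : 0 < c := by positivity
  obtain ⟨Z₁, hZ₁⟩ := exists_nat_gt (c / (ε / 2))
  refine ⟨Z₁ + 1, fun Z hZ => ?_⟩
  have hZ0 : Z ≠ 0 := by omega
  have hZpos : (0 : ℝ) < Z := by exact_mod_cast Nat.pos_of_ne_zero hZ0
  have hcZ : c * (Z : ℝ)⁻¹ ≤ ε / 2 := by
    rw [← div_eq_mul_inv, div_le_iff₀ hZpos]
    have : (Z₁ : ℝ) ≤ Z := by exact_mod_cast (by omega : Z₁ ≤ Z)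
    rw [div_lt_iff₀ (by positivity)] at hZ₁
    nlinarith
  have hd0 : (0 : ℝ) < d := by exact_mod_cast (by omega : 0 < d)
  have hKr : (0 : ℝ) < K := by exact_mod_cast hKpos
  have hpi := (tendsto_id.const_mul_atTop' hKpos).eventually
    (eventually_primeCounting_le_mul (ε := ε / (4 * d * K)) (by positivity))
  filter_upwards [hpi, eventually_gt_atTop Z] with N hpi hN
  simp only [id] at hpi
  set M : ℝ := 2 * N + 1 with hM
  have hMpos : 0 < M := by positivity
  have hNM : (N : ℝ) ≤ M := by rw [hM]; linarith [(Nat.cast_nonneg N : (0 : ℝ) ≤ N)]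
  set Pr := (Finset.Ioc Z (K * N)).filter Nat.Prime with hPr
  have hsub : (Nat.card {C // C ∈ cube (2 * d + 2) N ∧
        ∃ p : ℕ, p.Prime ∧ Z < p ∧ (p : ℤ) ^ (2 * d) ∣ resEval d C}) ≤
      (Pr.biUnion fun p => (cube (2 * d + 2) N).filter
        fun C => (p : ℤ) ^ (2 * d) ∣ resEval d C).card := by
    rw [← Nat.card_eq_finsetCard]
    refine Nat.card_mono (Finset.finite_toSet _) ?_
    rintro C ⟨hC, h⟩
    obtain ⟨p, hp, hZp, hpN, hdvd⟩ := exists_prime_le_of_pow_dvd_resEval hd hN hC h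
    simp only [Finset.coe_biUnion, Set.mem_iUnion]
    exact ⟨p, by simp [hPr, hp, hZp, hpN, hK], by simp [hC, hdvd]⟩
  have hterm : ∀ p ∈ Pr, (((cube (2 * d + 2) N).filter
      fun C => (p : ℤ) ^ (2 * d) ∣ resEval d C).card : ℝ) ≤
      c * M ^ (2 * d + 2) * ((p : ℝ) ^ 2)⁻¹ + 2 * d * M ^ (2 * d + 1) := by
    intro p hp
    rw [hPr, Finset.mem_filter, Finset.mem_Ioc] at hp
    have hp0 : (0 : ℝ) < p := by exact_mod_cast hp.2.pos
    have hpK : (p : ℝ) ≤ K * M := by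
      have : (p : ℝ) ≤ K * N := by exact_mod_cast hp.1.2
      nlinarith
    refine (card_filter_pow_dvd_resEval_le (by omega) hp.2 N).trans ?_
    rw [← hM]
    have h1 : M / p + 1 ≤ (1 + K) * (M / p) := by
      have : 1 ≤ K * M / p := by rwa [le_div_iff₀ hp0, one_mul]
      calc M / p + 1 ≤ M / p + K * M / p := by linarith
        _ = _ := by ring
    have h2 : (M / p + 1) ^ 2 ≤ ((1 + K) * (M / p)) ^ 2 :=
      pow_le_pow_left₀ (by positivity) h1 2
    calc _ ≤ 2 * d * (M / p ^ 2 + 1) * M ^ (2 * d + 1) +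
          ((1 + K) * (M / p)) ^ 2 * M ^ (2 * d) := by gcongr
      _ = _ := by
        rw [hc]
        field_simp
        ring
  have hsum : ∑ p ∈ Pr, ((p : ℝ) ^ 2)⁻¹ ≤ (Z : ℝ)⁻¹ := by
    calc _ ≤ ∑ p ∈ Finset.Ioc Z (K * N), ((p : ℝ) ^ 2)⁻¹ :=
          Finset.sum_le_sum_of_subset_of_nonneg (Finset.filter_subset _ _)
            fun _ _ _ => by positivity
      _ ≤ (Z : ℝ)⁻¹ - ((K * N : ℕ) : ℝ)⁻¹ := sum_Ioc_inv_sq_le_sub hZ0 (by nlinarith)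
      _ ≤ _ := by
        have : (0 : ℝ) ≤ ((K * N : ℕ) : ℝ)⁻¹ := by positivity
        linarith
  have hPrc : (Pr.card : ℝ) ≤ ε / (4 * d * K) * (K * N : ℕ) := by
    refine le_trans ?_ hpi
    rw [← Nat.primesLE_card_eq_primeCounting]
    norm_cast
    refine Finset.card_le_card fun p hp => ?_
    rw [hPr, Finset.mem_filter, Finset.mem_Ioc] at hp
    exact Nat.mem_primesBelow.2 ⟨by omega, hp.2⟩
  calc _ ≤ ((Pr.biUnion fun p => (cube (2 * d + 2) N).filter
        fun C => (p : ℤ) ^ (2 * d) ∣ resEval d C).card : ℝ) := by exact_mod_cast hsub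
    _ ≤ ∑ p ∈ Pr, (((cube (2 * d + 2) N).filter
        fun C => (p : ℤ) ^ (2 * d) ∣ resEval d C).card : ℝ) := by
        exact_mod_cast Finset.card_biUnion_le
    _ ≤ ∑ p ∈ Pr, (c * M ^ (2 * d + 2) * ((p : ℝ) ^ 2)⁻¹ + 2 * d * M ^ (2 * d + 1)) :=
        Finset.sum_le_sum hterm
    _ = c * (∑ p ∈ Pr, ((p : ℝ) ^ 2)⁻¹) * M ^ (2 * d + 2) +
        2 * d * Pr.card * M ^ (2 * d + 1) := by
        rw [Finset.sum_add_distrib, ← Finset.mul_sum, Finset.sum_const, nsmul_eq_mul]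
        ring
    _ ≤ ε / 2 * M ^ (2 * d + 2) + (ε / 2 * M) * M ^ (2 * d + 1) := by
        have h1 : c * ∑ p ∈ Pr, ((p : ℝ) ^ 2)⁻¹ ≤ ε / 2 :=
          (mul_le_mul_of_nonneg_left hsum hcpos.le).trans hcZ
        have h2 : 2 * d * (Pr.card : ℝ) ≤ ε / 2 * M := by
          calc 2 * d * (Pr.card : ℝ) ≤ 2 * d * (ε / (4 * d * K) * (K * N : ℕ)) := by gcongr
            _ = ε / 2 * N := by push_cast; field_simp; ring
            _ ≤ _ := by gcongr
        gcongr
    _ = _ := by ring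

end Tail
section Density

open scoped Classical in
/-- Equidistribution of the points of a large cube modulo `m`. -/
theorem tendsto_card_cube_residue (n : ℕ) {m : ℕ} (hm : m ≠ 0) (S : (Fin n → ZMod m) → Prop) :
    Tendsto (fun N : ℕ => (Nat.card {C // C ∈ cube n N ∧ S fun i => (C i : ZMod m)} : ℝ) /
      (2 * N + 1) ^ n) atTop (nhds ((Nat.card {Q // S Q} : ℝ) / (m : ℝ) ^ n)) := by
  have := NeZero.mk hm
  have hres : ∀ c : ZMod m, Tendsto (fun N : ℕ =>
      (((Finset.Icc (-N : ℤ) N).filter fun t : ℤ => (t : ZMod m) = c).card : ℝ) / (2 * N + 1))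
      atTop (nhds (m : ℝ)⁻¹) := by
    intro c
    have h0 : Tendsto (fun N : ℕ => (1 : ℝ) / (2 * N + 1)) atTop (nhds 0) := by
      refine tendsto_const_nhds.div_atTop (tendsto_atTop_add_const_right _ _ ?_)
      exact tendsto_natCast_atTop_atTop.const_mul_atTop two_pos
    rw [tendsto_iff_norm_sub_tendsto_zero]
    refine squeeze_zero (fun _ => norm_nonneg _) (fun N => ?_) h0
    have hN : (0 : ℝ) < 2 * N + 1 := by positivity
    have h := abs_card_residue_sub_le N hm c
    rw [Real.norm_eq_abs, le_div_iff₀ hN, ← abs_of_pos hN, ← abs_mul, abs_of_pos hN, sub_mul,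
      div_mul_cancel₀ _ hN.ne']
    rwa [div_eq_inv_mul] at h
  have hcard : ∀ N : ℕ, (Nat.card {C // C ∈ cube n N ∧ S fun i => (C i : ZMod m)} : ℝ) /
      (2 * N + 1) ^ n = ∑ Q ∈ Finset.univ.filter S, ∏ i,
        ((((Finset.Icc (-N : ℤ) N).filter fun t : ℤ => (t : ZMod m) = Q i).card : ℝ) /
          (2 * N + 1)) := by
    intro N
    have h1 : Nat.card {C // C ∈ cube n N ∧ S fun i => (C i : ZMod m)} =
        ((cube n N).filter fun C => S fun i => (C i : ZMod m)).card := by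
      rw [← Nat.card_eq_finsetCard]
      simp only [Finset.mem_filter]
    have h2 := Finset.card_eq_sum_card_fiberwise
      (f := fun (C : Fin n → ℤ) i => (C i : ZMod m)) (t := Finset.univ.filter S)
      (s := (cube n N).filter fun C => S fun i => (C i : ZMod m)) (by
        intro C hC
        simpa using (Finset.mem_filter.1 hC).2)
    rw [h1, h2]
    push_cast
    rw [Finset.sum_div]
    refine Finset.sum_congr rfl fun Q hQ => ?_
    rw [Finset.prod_div_distrib, Finset.prod_const, Finset.card_univ, Fintype.card_fin]
    congr 1
    norm_cast
    rw [← Fintype.card_piFinset]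
    congr 1
    ext C
    simp only [Finset.mem_filter, Fintype.mem_piFinset, cube, funext_iff]
    constructor
    · rintro ⟨⟨h1, -⟩, h3⟩
      exact fun i => ⟨h1 i, h3 i⟩
    · intro h
      refine ⟨⟨fun i => (h i).1, ?_⟩, fun i => (h i).2⟩
      rw [show (fun i => (C i : ZMod m)) = Q from funext fun i => (h i).2]
      exact (Finset.mem_filter.1 hQ).2
  simp only [hcard]
  have hlim : (Nat.card {Q // S Q} : ℝ) / (m : ℝ) ^ n =
      ∑ _Q ∈ Finset.univ.filter S, ∏ _i : Fin n, (m : ℝ)⁻¹ := by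
    rw [Finset.prod_const, Finset.sum_const, Finset.card_univ, Fintype.card_fin, nsmul_eq_mul,
      Nat.card_eq_fintype_card, Fintype.card_subtype, inv_pow, div_eq_mul_inv]
  rw [hlim]
  exact tendsto_finsetSum _ fun Q _ => tendsto_finsetProd _ fun i _ => hres (Q i)

open scoped Function in
/-- Equidistribution of the points of a large cube for several coprime moduli. -/
theorem tendsto_card_cube_residues (n : ℕ) {ι : Type*} [Fintype ι] (a : ι → ℕ)
    (ha : ∀ i, a i ≠ 0) (hco : Pairwise (Nat.Coprime on a)) (S : ∀ i, (Fin n → ZMod (a i)) → Prop) :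
    Tendsto (fun N : ℕ => (Nat.card {C // C ∈ cube n N ∧ ∀ i, S i fun j => (C j : ZMod (a i))} : ℝ) /
      (2 * N + 1) ^ n) atTop (nhds (∏ i, (Nat.card {Q // S i Q} : ℝ) / (a i : ℝ) ^ n)) := by
  have h := tendsto_card_cube_residue n (m := ∏ i, a i) (Finset.prod_ne_zero_iff.2 fun i _ => ha i)
    fun Q => ∀ i, S i fun j => ZMod.prodEquivPi a hco (Q j) i
  simp only [map_intCast, Pi.intCast_apply] at h
  convert h using 2
  have e : {Q : Fin n → ZMod (∏ i, a i) // ∀ i, S i fun j => ZMod.prodEquivPi a hco (Q j) i} ≃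
      ∀ i, {Q // S i Q} :=
    (Equiv.subtypeEquiv ((Equiv.arrowCongr (Equiv.refl (Fin n))
      (ZMod.prodEquivPi a hco).toEquiv).trans (Equiv.piComm fun _ i => ZMod (a i)))
      (q := fun f => ∀ i, S i (f i)) fun Q => Iff.rfl).trans Equiv.subtypePiEquivPi
  rw [Nat.card_congr e, Nat.card_pi, Finset.prod_div_distrib, Finset.prod_pow]
  push_cast
  rfl

/-- The points of `ℤ^n` satisfying a local condition at each prime have a density which is the
product of the local densities, as soon as the conditions at large primes rarely fail. -/
theorem exists_tendsto_density (n : ℕ) (a : ℕ → ℕ) (ha : ∀ p, p.Prime → a p ≠ 0)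
    (hco : ∀ p q, p.Prime → q.Prime → p ≠ q → (a p).Coprime (a q))
    (S : ∀ p, (Fin n → ZMod (a p)) → Prop)
    (htail : ∀ ε : ℝ, 0 < ε → ∃ Z₀ : ℕ, ∀ Z ≥ Z₀, ∀ᶠ N : ℕ in atTop,
      (Nat.card {C // C ∈ cube n N ∧ ∃ p : ℕ, p.Prime ∧ Z < p ∧
        ¬ S p fun j => (C j : ZMod (a p))} : ℝ) ≤ ε * (2 * N + 1) ^ n) :
    ∃ L : ℝ, Tendsto (fun Z : ℕ => ∏ p ∈ (Finset.range (Z + 1)).filter Nat.Prime,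
        (Nat.card {Q // S p Q} : ℝ) / (a p : ℝ) ^ n) atTop (nhds L) ∧
      Tendsto (fun N : ℕ => (Nat.card {C // C ∈ cube n N ∧
        ∀ p : ℕ, p.Prime → S p fun j => (C j : ZMod (a p))} : ℝ) / (2 * N + 1) ^ n)
        atTop (nhds L) := by
  set D : ℕ → ℝ := fun Z => ∏ p ∈ (Finset.range (Z + 1)).filter Nat.Prime,
        (Nat.card {Q // S p Q} : ℝ) / (a p : ℝ) ^ n with hD
  have hDnn : ∀ Z, 0 ≤ D Z := fun Z => Finset.prod_nonneg fun _ _ => by positivity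
  have hanti : Antitone D := by
    refine antitone_nat_of_succ_le fun Z => ?_
    simp only [hD]
    rw [Finset.range_add_one (n := Z + 1), Finset.filter_insert]
    split_ifs with hp
    · rw [Finset.prod_insert (by simp)]
      refine mul_le_of_le_one_left (hDnn Z) ?_
      have := NeZero.mk (ha _ hp)
      have hpos : (0 : ℝ) < (a (Z + 1) : ℝ) ^ n := by
        have := Nat.pos_of_ne_zero (ha _ hp)
        positivity
      rw [div_le_one hpos]
      have := Finite.card_subtype_le (S (Z + 1))
      rw [Nat.card_fun, Nat.card_zmod, Nat.card_fin] at this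
      exact_mod_cast this
    · exact le_rfl
  have hbdd : BddBelow (Set.range D) := ⟨0, by rintro _ ⟨Z, rfl⟩; exact hDnn Z⟩
  have hDL := tendsto_atTop_ciInf hanti hbdd
  set L := ⨅ Z, D Z
  refine ⟨L, hDL, ?_⟩
  have hfin : ∀ Z, Tendsto (fun N : ℕ => (Nat.card {C // C ∈ cube n N ∧
        ∀ p : ℕ, p.Prime → p ≤ Z → S p fun j => (C j : ZMod (a p))} : ℝ) / (2 * N + 1) ^ n)
        atTop (nhds (D Z)) := by
    intro Z
    have h := tendsto_card_cube_residues n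
      (ι := ((Finset.range (Z + 1)).filter Nat.Prime : Finset ℕ)) (fun p => a p)
      (fun p => ha _ (Finset.mem_filter.1 p.2).2)
      (fun p q hpq => hco _ _ (Finset.mem_filter.1 p.2).2 (Finset.mem_filter.1 q.2).2
        (Subtype.coe_injective.ne hpq)) (fun p => S p)
    have hprod := Finset.prod_coe_sort ((Finset.range (Z + 1)).filter Nat.Prime)
      fun p : ℕ => (Nat.card {Q // S p Q} : ℝ) / (a p : ℝ) ^ n
    rw [hprod] at h
    convert h using 6 with N
    ext C
    simp only [Subtype.forall, Finset.mem_filter, Finset.mem_range, Nat.lt_succ_iff]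
    tauto
  rw [Metric.tendsto_atTop]
  intro ε hε
  obtain ⟨Z₀, hZ₀⟩ := htail (ε / 4) (by positivity)
  obtain ⟨Z₁, hZ₁⟩ := Metric.tendsto_atTop.1 hDL (ε / 4) (by positivity)
  set Z := max Z₀ Z₁
  obtain ⟨N₀, hN₀⟩ := Filter.eventually_atTop.1 (hZ₀ Z (le_max_left _ _))
  obtain ⟨N₁, hN₁⟩ := Metric.tendsto_atTop.1 (hfin Z) (ε / 4) (by positivity)
  refine ⟨max N₀ N₁, fun N hN => ?_⟩
  have h1 := hZ₁ Z (le_max_right _ _)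
  have h2 := hN₀ N (le_trans (le_max_left _ _) hN)
  have h3 := hN₁ N (le_trans (le_max_right _ _) hN)
  set A : Set (Fin n → ℤ) := {C | C ∈ cube n N ∧
    ∀ p : ℕ, p.Prime → S p fun j => (C j : ZMod (a p))} with hA
  set B : Set (Fin n → ℤ) := {C | C ∈ cube n N ∧
    ∀ p : ℕ, p.Prime → p ≤ Z → S p fun j => (C j : ZMod (a p))} with hB
  set T : Set (Fin n → ℤ) := {C | C ∈ cube n N ∧
    ∃ p : ℕ, p.Prime ∧ Z < p ∧ ¬ S p fun j => (C j : ZMod (a p))} with hT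
  change (Nat.card T : ℝ) ≤ _ at h2
  change dist ((Nat.card B : ℝ) / _) _ < _ at h3
  change dist ((Nat.card A : ℝ) / _) _ < _
  have hBf : B.Finite := (cube n N).finite_toSet.subset fun C hC => hC.1
  have hTf : T.Finite := (cube n N).finite_toSet.subset fun C hC => hC.1
  have hAB : A ⊆ B := fun C hC => ⟨hC.1, fun p hp _ => hC.2 p hp⟩
  have hBAT : B ⊆ A ∪ T := by
    intro C hC
    by_cases h : ∃ p : ℕ, p.Prime ∧ Z < p ∧ ¬ S p fun j => (C j : ZMod (a p))
    · exact Or.inr ⟨hC.1, h⟩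
    · push Not at h
      exact Or.inl ⟨hC.1, fun p hp => (le_or_gt p Z).elim (hC.2 p hp) (h p hp)⟩
  have c1 : (Nat.card A : ℝ) ≤ Nat.card B := by exact_mod_cast Nat.card_mono hBf hAB
  have c2 : (Nat.card B : ℝ) ≤ Nat.card A + Nat.card T := by
    have := (Nat.card_mono ((hBf.subset hAB).union hTf) hBAT)
    simp only [Nat.card_coe_set_eq] at this ⊢
    exact_mod_cast this.trans (Set.ncard_union_le _ _)
  have hpos : (0 : ℝ) < (2 * N + 1) ^ n := by positivity
  have d1 := div_le_div_of_nonneg_right c1 hpos.le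
  have d2 := div_le_div_of_nonneg_right c2 hpos.le
  rw [add_div] at d2
  rw [← div_le_iff₀ hpos] at h2
  rw [Real.dist_eq, abs_lt] at *
  constructor <;> linarith [h1.1, h1.2, h3.1, h3.2]

end Density
section Signs

variable {n : ℕ}

theorem pos_neg_iff_not_pos {C : Fin n → ℤ} (hC : C ≠ 0) :
    (∃ i, 0 < (-C) i ∧ ∀ j, j < i → (-C) j = 0) ↔ ¬ ∃ i, 0 < C i ∧ ∀ j, j < i → C j = 0 := by
  obtain ⟨i, hi, hmin⟩ := WellFounded.has_min (wellFounded_lt (α := Fin n)) {i | C i ≠ 0}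
    (Function.ne_iff.1 hC)
  have hz : ∀ j, j < i → C j = 0 := fun j hj => by
    by_contra h
    exact hmin j h hj
  have key : ∀ s : ℤ, s ≠ 0 → ((∃ k, 0 < s * C k ∧ ∀ j, j < k → s * C j = 0) ↔ 0 < s * C i) := by
    intro s hs
    constructor
    · rintro ⟨k, hk, hkz⟩
      rcases lt_trichotomy k i with h | rfl | h
      · simp [hz k h] at hk
      · exact hk
      · exact absurd (hkz i h) (mul_ne_zero hs hi)
    · exact fun h => ⟨i, h, fun j hj => by rw [hz j hj, mul_zero]⟩
  have h1 := key 1 one_ne_zero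
  have h2 := key (-1) (by norm_num)
  simp only [one_mul, neg_one_mul] at h1 h2
  simp only [Pi.neg_apply]
  rw [h1, h2]
  have : C i ≠ 0 := hi
  omega

/-- Exactly half of the points of a symmetric set avoiding the origin have a positive first nonzero
coordinate. -/
theorem two_mul_card_filter_pos (N : ℕ) (A : (Fin n → ℤ) → Prop) (h0 : ¬ A 0)
    (hneg : ∀ C, A C → A (-C)) :
    2 * Nat.card {C // C ∈ cube n N ∧ A C ∧ ∃ i, 0 < C i ∧ ∀ j, j < i → C j = 0} =
      Nat.card {C // C ∈ cube n N ∧ A C} := by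
  classical
  have hne : ∀ C, A C → C ≠ 0 := by rintro C hC rfl; exact h0 hC
  have hA : Nat.card {C // C ∈ cube n N ∧ A C} = ((cube n N).filter A).card := by
    rw [← Nat.card_eq_finsetCard]; simp only [Finset.mem_filter]
  have hAP : Nat.card {C // C ∈ cube n N ∧ A C ∧ ∃ i, 0 < C i ∧ ∀ j, j < i → C j = 0} =
      (((cube n N).filter A).filter fun C => ∃ i, 0 < C i ∧ ∀ j, j < i → C j = 0).card := by
    rw [← Nat.card_eq_finsetCard]; simp only [Finset.mem_filter, and_assoc]
  rw [hA, hAP, ← Finset.card_filter_add_card_filter_not (s := (cube n N).filter A)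
    fun C => ∃ i, 0 < C i ∧ ∀ j, j < i → C j = 0, two_mul]
  congr 1
  refine Finset.card_nbij' (fun C => -C) (fun C => -C) ?_ ?_
    (fun C _ => neg_neg C) (fun C _ => neg_neg C)
  · intro C hC
    rw [Finset.mem_coe, Finset.mem_filter, Finset.mem_filter, mem_cube] at *
    refine ⟨⟨by simpa using hC.1.1, hneg C hC.1.2⟩, ?_⟩
    rw [pos_neg_iff_not_pos (hne C hC.1.2)]
    simpa using hC.2
  · intro C hC
    rw [Finset.mem_coe, Finset.mem_filter, Finset.mem_filter, mem_cube] at *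
    refine ⟨⟨by simpa using hC.1.1, hneg C hC.1.2⟩, ?_⟩
    rw [pos_neg_iff_not_pos (hne C hC.1.2)]
    exact hC.2

end Signs

section Primitive

theorem half_le_prod_one_sub_inv_pow {n : ℕ} (hn : 2 ≤ n) (Z : ℕ) :
    (1 / 2 : ℝ) ≤ ∏ p ∈ (Finset.range (Z + 1)).filter Nat.Prime, (1 - 1 / (p : ℝ) ^ n) := by
  have key : ∀ Z : ℕ, ((Z : ℝ) + 2) / (2 * (Z + 1)) ≤
      ∏ p ∈ (Finset.range (Z + 1 + 1)).filter Nat.Prime, (1 - 1 / (p : ℝ) ^ n) := by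
    intro Z
    induction Z with
    | zero =>
      have : (Finset.range (0 + 1 + 1)).filter Nat.Prime = ∅ := by decide
      rw [this]
      simp
    | succ Z ih =>
      have hstep : (((Z + 1 : ℕ) : ℝ) + 2) / (2 * ((Z + 1 : ℕ) + 1)) =
          (1 - 1 / ((Z + 1 + 1 : ℕ) : ℝ) ^ 2) * (((Z : ℝ) + 2) / (2 * (Z + 1))) := by
        push_cast
        field_simp
        ring
      have hone : (1 : ℝ) ≤ ((Z + 1 + 1 : ℕ) : ℝ) := by
        push_cast; linarith [Nat.cast_nonneg (α := ℝ) Z]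
      have hle : (1 - 1 / ((Z + 1 + 1 : ℕ) : ℝ) ^ 2) ≤ 1 - 1 / ((Z + 1 + 1 : ℕ) : ℝ) ^ n := by
        gcongr
      have hnn : (0 : ℝ) ≤ 1 - 1 / ((Z + 1 + 1 : ℕ) : ℝ) ^ 2 := by
        rw [sub_nonneg, div_le_one (by positivity)]
        exact one_le_pow₀ hone
      have hfrac : (0 : ℝ) ≤ ((Z : ℝ) + 2) / (2 * (Z + 1)) := by positivity
      rw [Finset.range_add_one (n := Z + 1 + 1), Finset.filter_insert, hstep]
      split_ifs with hp
      · rw [Finset.prod_insert (by simp)]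
        exact mul_le_mul hle ih hfrac (hnn.trans hle)
      · refine le_trans (mul_le_of_le_one_left hfrac ?_) ih
        have : (0 : ℝ) ≤ 1 / ((Z + 1 + 1 : ℕ) : ℝ) ^ 2 := by positivity
        linarith
  rcases Z with _ | Z
  · have : (Finset.range (0 + 1)).filter Nat.Prime = ∅ := by decide
    rw [this]
    norm_num
  · refine le_trans ?_ (key Z)
    rw [div_le_div_iff₀ (by positivity) (by positivity)]
    linarith

theorem gcd_eq_one_iff_forall_prime {n : ℕ} (C : Fin n → ℤ) :
    Finset.univ.gcd C = 1 ↔ ∀ p : ℕ, p.Prime → (fun i => (C i : ZMod p)) ≠ 0 := by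
  have hz : ∀ p : ℕ, (fun i => (C i : ZMod p)) = 0 ↔ (p : ℤ) ∣ Finset.univ.gcd C := by
    intro p
    simp [funext_iff, Finset.dvd_gcd_iff, ZMod.intCast_zmod_eq_zero_iff_dvd]
  simp only [ne_eq, hz]
  constructor
  · intro h p hp hdvd
    rw [h] at hdvd
    exact hp.one_lt.ne' (by exact_mod_cast Int.eq_one_of_dvd_one (by positivity) hdvd)
  · intro h
    by_contra hne
    have hnat : (Finset.univ.gcd C).natAbs ≠ 1 := by
      intro h1
      apply hne
      rw [← Finset.normalize_gcd]
      exact normalize_eq_one.2 (Int.isUnit_iff_natAbs_eq.2 h1)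
    obtain ⟨p, hp, hdvd⟩ := Nat.exists_prime_and_dvd hnat
    exact h p hp (Int.natCast_dvd.2 hdvd)

variable {d : ℕ}

theorem pow_dvd_resEval_of_dvd {p : ℕ} {C : Fin (2 * d + 2) → ℤ}
    (h : (fun i => (C i : ZMod p)) = 0) : (p : ℤ) ^ (2 * d) ∣ resEval d C := by
  have h' : ∀ i, (p : ℤ) ∣ C i := fun i =>
    (ZMod.intCast_zmod_eq_zero_iff_dvd _ _).1 (congrFun h i)
  choose c hc using h'
  have : C = (p : ℤ) • c := funext hc
  rw [this, resEval_smul]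
  exact dvd_mul_right _ _

theorem resEval_zmod_ne_zero_iff (m : ℕ) (C : Fin (2 * d + 2) → ℤ) :
    resEval d (fun i => (C i : ZMod m)) ≠ 0 ↔ ¬ (m : ℤ) ∣ resEval d C := by
  have h := map_resEval (Int.castRingHom (ZMod m)) C
  simp only [eq_intCast] at h
  rw [← h, ne_eq, ZMod.intCast_zmod_eq_zero_iff_dvd]

theorem mem_WSigma_iff (hd : 2 ≤ d) {Sig : Finset ℕ} (hSig : ∀ p ∈ Sig, Nat.Prime p)
    (C : Fin (2 * d + 2) → ℤ) :
    C ∈ WSigma d Sig ↔ (∀ p : ℕ, p.Prime →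
      resEval d (fun i => (C i : ZMod (p ^ if p ∈ Sig then 1 else 2 * d))) ≠ 0) ∧
        ∃ i, 0 < C i ∧ ∀ j, j < i → C j = 0 := by
  have hle : ∀ p : ℕ, (p : ℤ) ^ (if p ∈ Sig then 1 else 2 * d) ∣ (p : ℤ) ^ (2 * d) := fun p =>
    pow_dvd_pow _ (by split_ifs <;> omega)
  simp only [resEval_zmod_ne_zero_iff, WSigma, projPts, Set.mem_ofPred_eq,
    gcd_eq_one_iff_forall_prime, Nat.cast_pow]
  constructor
  · rintro ⟨⟨-, hpos⟩, h1, h2⟩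
    refine ⟨fun p hp => ?_, hpos⟩
    split_ifs with h
    · simpa using h1 p h
    · exact h2 p hp
  · rintro ⟨h, hpos⟩
    refine ⟨⟨fun p hp h0 => h p hp ((hle p).trans (pow_dvd_resEval_of_dvd h0)), hpos⟩,
      fun p hp => ?_, fun p hp h0 => h p hp ((hle p).trans h0)⟩
    simpa [hp] using h p (hSig p hp)

theorem card_inter_height_eq (A : Set (Fin (2 * d + 2) → ℤ)) {x : ℝ} (hx : 0 ≤ x) :
    Nat.card ↥(A ∩ {C | ∀ i, |(C i : ℝ)| ≤ x}) =
      Nat.card {C // C ∈ cube (2 * d + 2) ⌊x⌋₊ ∧ C ∈ A} := by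
  refine Nat.card_congr (Equiv.subtypeEquivRight fun C => ?_)
  rw [mem_cube, and_comm, Set.mem_inter_iff, and_congr_right_iff]
  intro _
  refine forall_congr' fun i => ?_
  rw [Int.abs_eq_natAbs, Int.ofNat_le, Nat.le_floor_iff hx, Nat.cast_natAbs, Int.cast_abs]

end Primitive

/-- the height density of `W_Σ` exists and equals
`(∏_{p∈Σ} π_p^{(1)})·(∏_{p∉Σ} π_p^{(2d)})`. -/
theorem stmt_11 (d : ℕ) (hd : 2 ≤ d) (Sig : Finset ℕ) (hSig : ∀ p ∈ Sig, Nat.Prime p) :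
    ∃ L : ℝ,
      Tendsto (fun Z : ℕ =>
          (∏ p ∈ Sig, piLocal d p 1) *
            ∏ p ∈ (Finset.range (Z + 1)).filter (fun p => Nat.Prime p ∧ p ∉ Sig),
              piLocal d p (2 * d))
        atTop (nhds L) ∧
      Tendsto (fun x : ℝ =>
          (Nat.card ↥(WSigma d Sig ∩ {C | ∀ i, |(C i : ℝ)| ≤ x}) : ℝ) /
          (Nat.card ↥(projPts d ∩ {C | ∀ i, |(C i : ℝ)| ≤ x}) : ℝ))
        atTop (nhds L) := by
  classical
  set k : ℕ → ℕ := fun p => if p ∈ Sig then 1 else 2 * d with hk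
  obtain ⟨LA, hA1, hA2⟩ := exists_tendsto_density (2 * d + 2) (fun p => p ^ k p)
    (fun p hp => pow_ne_zero _ hp.ne_zero)
    (fun p q hp hq hpq => Nat.Coprime.pow _ _ ((Nat.coprime_primes hp hq).2 hpq))
    (fun p Q => resEval d Q ≠ 0) (by
      intro ε hε
      obtain ⟨Z₀, hZ₀⟩ := exists_eventually_card_filter_pow_dvd_resEval_le hd hε
      refine ⟨max Z₀ (Sig.sup id), fun Z hZ => ?_⟩
      filter_upwards [hZ₀ Z (le_trans (le_max_left _ _) hZ)] with N hN
      refine le_trans ?_ hN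
      norm_cast
      refine Nat.card_mono ((cube (2 * d + 2) N).finite_toSet.subset fun C hC => hC.1) ?_
      rintro C ⟨hC, p, hp, hZp, h⟩
      refine ⟨hC, p, hp, hZp, ?_⟩
      have hpS : p ∉ Sig := fun hpS => by
        have := (Finset.le_sup (f := id) hpS).trans ((le_max_right Z₀ _).trans hZ)
        simp only [id] at this
        omega
      have h' := not_not.1 (mt (resEval_zmod_ne_zero_iff _ C).2 h)
      simpa [hk, hpS] using h')
  obtain ⟨LP, hP1, hP2⟩ := exists_tendsto_density (2 * d + 2) (fun p => p)
    (fun p hp => hp.ne_zero) (fun p q hp hq hpq => (Nat.coprime_primes hp hq).2 hpq)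
    (fun p Q => Q ≠ 0) (by
      intro ε hε
      obtain ⟨Z₀, hZ₀⟩ := exists_eventually_card_filter_pow_dvd_resEval_le hd hε
      refine ⟨Z₀, fun Z hZ => ?_⟩
      filter_upwards [hZ₀ Z hZ] with N hN
      refine le_trans ?_ hN
      norm_cast
      refine Nat.card_mono ((cube (2 * d + 2) N).finite_toSet.subset fun C hC => hC.1) ?_
      rintro C ⟨hC, p, hp, hZp, h⟩
      exact ⟨hC, p, hp, hZp, pow_dvd_resEval_of_dvd (not_not.1 h)⟩)
  have hPloc : ∀ p : ℕ, p.Prime →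
      (Nat.card {Q : Fin (2 * d + 2) → ZMod p // Q ≠ 0} : ℝ) / (p : ℝ) ^ (2 * d + 2) =
        1 - 1 / (p : ℝ) ^ (2 * d + 2) := by
    intro p hp
    have := NeZero.mk hp.ne_zero
    have hp0 : (0 : ℝ) < p := by exact_mod_cast hp.pos
    rw [Nat.card_eq_fintype_card, Fintype.card_subtype_compl, Fintype.card_subtype_eq,
      Fintype.card_fun, ZMod.card, Fintype.card_fin,
      Nat.cast_sub (Nat.one_le_pow _ _ hp.pos)]
    push_cast
    field_simp
  have hPprod : (fun Z : ℕ => ∏ p ∈ (Finset.range (Z + 1)).filter Nat.Prime,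
      (Nat.card {Q : Fin (2 * d + 2) → ZMod p // Q ≠ 0} : ℝ) / (p : ℝ) ^ (2 * d + 2)) =
      fun Z : ℕ => ∏ p ∈ (Finset.range (Z + 1)).filter Nat.Prime,
        (1 - 1 / (p : ℝ) ^ (2 * d + 2)) :=
    funext fun Z => Finset.prod_congr rfl fun p hp => hPloc p (Finset.mem_filter.1 hp).2
  rw [hPprod] at hP1
  have hLP : LP ≠ 0 := by
    have : (1 / 2 : ℝ) ≤ LP := ge_of_tendsto' hP1 (half_le_prod_one_sub_inv_pow (by omega))
    linarith
  refine ⟨LA / LP, ?_, ?_⟩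
  · refine (hA1.div hP1 hLP).congr' ?_
    filter_upwards [eventually_ge_atTop (Sig.sup id)] with Z hZ
    have hunion : (Finset.range (Z + 1)).filter Nat.Prime =
        Sig ∪ (Finset.range (Z + 1)).filter fun p => Nat.Prime p ∧ p ∉ Sig := by
      ext p
      simp only [Finset.mem_union, Finset.mem_filter, Finset.mem_range]
      by_cases hp : p ∈ Sig
      · have := (Finset.le_sup (f := id) hp).trans hZ
        simp only [id] at this
        simp [hp, hSig p hp, this]
      · simp [hp]
    have hdisj : Disjoint Sig ((Finset.range (Z + 1)).filter fun p => Nat.Prime p ∧ p ∉ Sig) :=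
      Finset.disjoint_left.2 fun p hp hp' => (Finset.mem_filter.1 hp').2.2 hp
    rw [Pi.div_apply, ← Finset.prod_div_distrib, hunion, Finset.prod_union hdisj]
    have hloc : ∀ p, (Nat.card {Q : Fin (2 * d + 2) → ZMod (p ^ k p) // resEval d Q ≠ 0} : ℝ) /
        ((p ^ k p : ℕ) : ℝ) ^ (2 * d + 2) / (1 - 1 / (p : ℝ) ^ (2 * d + 2)) =
        piLocal d p (k p) := by
      intro p
      rw [piLocal, div_div, Nat.cast_pow, ← pow_mul, mul_comm (k p)]
    simp only [hloc]
    congr 1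
    · exact Finset.prod_congr rfl fun p hp => by simp [hk, hp]
    · exact Finset.prod_congr rfl fun p hp => by simp [hk, (Finset.mem_filter.1 hp).2.2]
  · refine ((hA2.div hP2 hLP).comp tendsto_nat_floor_atTop).congr' ?_
    filter_upwards [eventually_ge_atTop 0] with x hx
    rw [card_inter_height_eq _ hx, card_inter_height_eq _ hx]
    have hres0 : resEval d (0 : Fin (2 * d + 2) → ℤ) = 0 := by
      have := resEval_smul (d := d) (0 : ℤ) 0
      rwa [zero_smul, zero_pow (by omega), zero_mul] at this
    have hA := two_mul_card_filter_pos (n := 2 * d + 2) ⌊x⌋₊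
      (fun C => ∀ p : ℕ, p.Prime → resEval d (fun i => (C i : ZMod (p ^ k p))) ≠ 0)
      (fun h => by
        have := h 2 Nat.prime_two
        rw [resEval_zmod_ne_zero_iff, hres0] at this
        exact this (dvd_zero _))
      (fun C h p hp => by
        have h1 := h p hp
        have h2 := resEval_smul (d := d) (-1 : ℤ) C
        rw [neg_one_smul, pow_mul, neg_one_sq, one_pow, one_mul] at h2
        rw [resEval_zmod_ne_zero_iff] at h1 ⊢
        rwa [h2])
    have hP := two_mul_card_filter_pos (n := 2 * d + 2) ⌊x⌋₊
      (fun C => ∀ p : ℕ, p.Prime → (fun i => (C i : ZMod p)) ≠ 0)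
      (fun h => h 2 Nat.prime_two (by ext; simp))
      (fun C h p hp h0 => h p hp (by
        ext i
        simpa using congrFun h0 i))
    have hM : ((2 * (⌊x⌋₊ : ℝ) + 1) ^ (2 * d + 2)) ≠ 0 := by positivity
    simp only [Function.comp, Pi.div_apply]
    rw [div_div_div_cancel_right₀ hM]
    simp only [mem_WSigma_iff hd hSig]
    simp only [projPts, Set.mem_ofPred_eq, gcd_eq_one_iff_forall_prime]
    rw [← hA, ← hP]
    push_cast
    exact mul_div_mul_left _ _ two_ne_zero
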